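/- Let K be a field, S = MvPolynomial (Fin n) K, and let I ⊆ S be an ideal generated by q monomials (say I is the span of the monomials with exponent vectors a 1, …, a q : Fin n →₀ ℕ). Then the projective dimension of the S-module I² is at most C(q,2) = q(q−1)/2; i.e., I² has projective dimension ≤ q.choose 2 in the sense of Mathlib's projective dimension for modules. -/

import Mathlib

open CategoryTheory

/-- A module `M` over `R` has projective dimension at most `n` if it admits a projective
resolution whose components vanish in homological degrees greater than `n`. -/
def HasProjDimLE (R : Type) [Ring R] (M : Type) [AddCommGroup M] [Module R M] (n : ℕ) : Prop :=
  ∃ P : ProjectiveResolution (ModuleCat.of R M),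
    ∀ i : ℕ, n < i → Limits.IsZero (P.complex.X i)


open Limits in
lemma exists_res {C : Type*} [Category C] [Abelian C] [EnoughProjectives C] (N : ℕ) :
    ∀ (M : C), HasProjectiveDimensionLT M (N + 1) →
    ∃ P : ProjectiveResolution M, ∀ i : ℕ, N < i → IsZero (P.complex.X i) := by
  induction N with
  | zero =>
    intro M h
    have : Projective M := projective_iff_hasProjectiveDimensionLT_one.2 h
    refine ⟨ProjectiveResolution.self M, fun i hi => ?_⟩
    exact HomologicalComplex.isZero_single_obj_X _ _ _ _ (by omega)
  | succ N ih =>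
    intro M h
    let p := Projective.π M
    let S : ShortComplex C := ShortComplex.mk (kernel.ι p) p (by simp)
    have hS : S.ShortExact :=
      { exact := ShortComplex.exact_kernel p
        mono_f := inferInstanceAs (Mono (kernel.ι p))
        epi_g := inferInstanceAs (Epi p) }
    have hP : Projective S.X₂ := Projective.projective_over M
    obtain ⟨Q, hQ⟩ := ih (kernel p)
      (hS.hasProjectiveDimensionLT_X₁ (N + 1) inferInstance h)
    let q : Q.complex.X 0 ⟶ kernel p := Q.π.f 0
    have hq : Epi q := inferInstanceAs (Epi (Q.π.f 0))
    have hdq : Q.complex.d 1 0 ≫ q = 0 := Q.complex_d_comp_π_f_zero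
    have hw : Q.complex.d 1 0 ≫ q ≫ kernel.ι p = 0 := by rw [reassoc_of% hdq, zero_comp]
    let A := ChainComplex.augment Q.complex (q ≫ kernel.ι p) hw
    have hA0 : A.d 1 0 ≫ p = 0 := by
      change (q ≫ kernel.ι p) ≫ p = 0
      simp
    have ex0 : (ShortComplex.mk (q ≫ kernel.ι p) p (by simp)).Exact := by
      let α : ShortComplex.mk (q ≫ kernel.ι p) p (by simp) ⟶ S :=
        { τ₁ := q, τ₂ := 𝟙 _, τ₃ := 𝟙 _ }
      rw [ShortComplex.exact_iff_of_epi_of_isIso_of_mono α]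
      exact hS.exact
    have ex1 : (ShortComplex.mk (Q.complex.d 1 0) (q ≫ kernel.ι p) hw).Exact := by
      let α : ShortComplex.mk (Q.complex.d 1 0) q hdq ⟶ 
          ShortComplex.mk (Q.complex.d 1 0) (q ≫ kernel.ι p) hw :=
        { τ₁ := 𝟙 _, τ₂ := 𝟙 _, τ₃ := kernel.ι p }
      rw [← ShortComplex.exact_iff_of_epi_of_isIso_of_mono α]
      exact Q.exact₀
    have exs : ∀ n, A.ExactAt (n + 1) := by
      intro n
      rw [HomologicalComplex.exactAt_iff' _ (n + 1 + 1) (n + 1) n (by simp) (by simp)]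
      match n with
      | 0 => exact ex1
      | n + 1 => exact Q.exact_succ n
    have hp : ((ChainComplex.toSingle₀Equiv A M).symm ⟨p, hA0⟩).f 0 = p :=
      ChainComplex.toSingle₀Equiv_symm_apply_f_zero (C := A) (X := M) p hA0
    refine ⟨{ complex := A
              projective := ?_
              π := (ChainComplex.toSingle₀Equiv _ _).symm ⟨p, hA0⟩
              quasiIso := ⟨fun n => ?_⟩ }, ?_⟩
    · rintro (_ | n)
      · exact hP
      · exact Q.projective n
    · cases n with
      | zero =>
        rw [ChainComplex.quasiIsoAt₀_iff, ShortComplex.quasiIso_iff_of_zeros']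
        · refine (ShortComplex.exact_and_epi_g_iff_of_iso ?_).2 ⟨ex0, inferInstanceAs (Epi p)⟩
          exact ShortComplex.isoMk (Iso.refl _) (Iso.refl _) (Iso.refl _)
            ((Category.id_comp _).trans (Category.comp_id _).symm)
            (by
              refine (Category.id_comp p).trans ?_
              exact hp.symm.trans (Category.comp_id _).symm)
        all_goals rfl
      | succ n =>
        rw [quasiIsoAt_iff_exactAt']
        · exact exs n
        · apply ChainComplex.exactAt_succ_single_obj
    · rintro (_ | i) hi
      · omega
      · exact hQ i (by omega)

lemma colon_mono {n : ℕ} {K : Type} [Field K] (s : Set (Fin n →₀ ℕ)) (b : Fin n →₀ ℕ)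
    (x : MvPolynomial (Fin n) K) :
    x ∈ Ideal.span ((fun s => MvPolynomial.monomial s (1 : K)) '' ((fun c => c - b) '' s)) ↔
    x * MvPolynomial.monomial b (1 : K) ∈
      Ideal.span ((fun s => MvPolynomial.monomial s (1 : K)) '' s) := by
  rw [MvPolynomial.mem_ideal_span_monomial_image, MvPolynomial.mem_ideal_span_monomial_image]
  simp only [MvPolynomial.mem_support_iff, Set.exists_mem_image, tsub_le_iff_right]
  constructor
  · intro h y hy
    rw [MvPolynomial.coeff_mul_monomial'] at hy
    split_ifs at hy with hb
    · have := h (y - b) (by simpa using hy)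
      simpa [tsub_add_cancel_of_le hb] using this
    · simp at hy
  · intro h y hy
    exact h (y + b) (by simpa [MvPolynomial.coeff_mul_monomial] using hy)

lemma pd_step {R : Type} [CommRing R] (J C J' : Ideal R) (m : R)
    (hC : ∀ x, x ∈ C ↔ x * m ∈ J) (hJ' : J' = J ⊔ Ideal.span {m}) (N : ℕ)
    (h1 : HasProjectiveDimensionLT (ModuleCat.of R (R ⧸ C)) N)
    (h2 : HasProjectiveDimensionLT (ModuleCat.of R (R ⧸ J)) (N + 1)) :
    HasProjectiveDimensionLT (ModuleCat.of R (R ⧸ J')) (N + 1) := by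
  have hle : J ≤ J' := hJ' ▸ le_sup_left
  let f : (R ⧸ C) →ₗ[R] (R ⧸ J) :=
    Submodule.mapQ C J (LinearMap.mulRight R m) (fun x hx => (hC x).1 hx)
  let g : (R ⧸ J) →ₗ[R] (R ⧸ J') := Submodule.mapQ J J' LinearMap.id hle
  have hf : Function.Injective f := by
    rw [injective_iff_map_eq_zero]
    intro x hx
    induction x using Submodule.Quotient.induction_on with
    | H x =>
      change (Submodule.Quotient.mk (x * m) : R ⧸ J) = 0 at hx
      rw [Submodule.Quotient.mk_eq_zero] at hx
      rw [Submodule.Quotient.mk_eq_zero]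
      exact (hC x).2 hx
  have hg : Function.Surjective g := by
    intro x
    induction x using Submodule.Quotient.induction_on with
    | H x => exact ⟨Submodule.Quotient.mk x, rfl⟩
  have hfg : Function.Exact f g := by
    intro y
    induction y using Submodule.Quotient.induction_on with
    | H y =>
      change (Submodule.Quotient.mk y : R ⧸ J') = 0 ↔ _
      rw [Submodule.Quotient.mk_eq_zero]
      constructor
      · intro hy
        rw [hJ', Submodule.mem_sup] at hy
        obtain ⟨u, hu, v, hv, rfl⟩ := hy
        obtain ⟨r, rfl⟩ := Ideal.mem_span_singleton'.1 hv
        refine ⟨Submodule.Quotient.mk r, ?_⟩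
        change (Submodule.Quotient.mk (r * m) : R ⧸ J) = _
        rw [Submodule.Quotient.eq]
        simpa using hu
      · rintro ⟨x, hx⟩
        induction x using Submodule.Quotient.induction_on with
        | H x =>
          change (Submodule.Quotient.mk (x * m) : R ⧸ J) = _ at hx
          rw [Submodule.Quotient.eq] at hx
          have h3 : x * m ∈ J' := hJ' ▸ Ideal.mem_sup_right
            (Ideal.mul_mem_left _ _ (Ideal.mem_span_singleton_self m))
          have := J'.sub_mem h3 (hle hx)
          simpa using this
  let S : ShortComplex (ModuleCat R) := ShortComplex.mk (ModuleCat.ofHom f) (ModuleCat.ofHom g)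
    (by apply ModuleCat.hom_ext; exact LinearMap.ext hfg.apply_apply_eq_zero)
  have hS : S.ShortExact :=
    { exact := (ShortComplex.ShortExact.moduleCat_exact_iff_function_exact S).2 hfg
      mono_f := (ModuleCat.mono_iff_injective _).2 hf
      epi_g := (ModuleCat.epi_iff_surjective _).2 hg }
  exact hS.hasProjectiveDimensionLT_X₃ N h1 h2

lemma pd_ideal {R : Type} [CommRing R] (J : Ideal R) (N : ℕ)
    (h : HasProjectiveDimensionLT (ModuleCat.of R (R ⧸ J)) (N + 2)) :
    HasProjectiveDimensionLT (ModuleCat.of R J) (N + 1) := by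
  let S : ShortComplex (ModuleCat R) := ShortComplex.mk (ModuleCat.ofHom J.subtype)
    (ModuleCat.ofHom J.mkQ) (by apply ModuleCat.hom_ext; exact LinearMap.ext (LinearMap.exact_subtype_mkQ J).apply_apply_eq_zero)
  have hS : S.ShortExact :=
    { exact := (ShortComplex.ShortExact.moduleCat_exact_iff_function_exact S).2
        (LinearMap.exact_subtype_mkQ J)
      mono_f := (ModuleCat.mono_iff_injective _).2 J.injective_subtype
      epi_g := (ModuleCat.epi_iff_surjective _).2 J.mkQ_surjective }
  have : Projective S.X₂ := (IsProjective.iff_projective (R := R) R).1 inferInstance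
  exact hS.hasProjectiveDimensionLT_X₁ (N+1) inferInstance h

lemma pd_taylor {n : ℕ} {K : Type} [Field K] (N : ℕ) : ∀ s : Finset (Fin n →₀ ℕ), s.card ≤ N →
    HasProjectiveDimensionLT (ModuleCat.of (MvPolynomial (Fin n) K) (MvPolynomial (Fin n) K ⧸
      Ideal.span ((fun s => MvPolynomial.monomial s (1 : K)) '' (s : Set (Fin n →₀ ℕ))))) (N + 1) := by
  classical
  have base : ∀ N, HasProjectiveDimensionLT (ModuleCat.of (MvPolynomial (Fin n) K) (MvPolynomial (Fin n) K ⧸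
      Ideal.span ((fun s => MvPolynomial.monomial s (1 : K)) '' ((∅ : Finset (Fin n →₀ ℕ)) : Set (Fin n →₀ ℕ))))) (N + 1) := by
    intro N
    have e : Ideal.span ((fun s => MvPolynomial.monomial s (1 : K)) '' ((∅ : Finset (Fin n →₀ ℕ)) : Set (Fin n →₀ ℕ))) = ⊥ := by simp
    rw [e]
    have : Module.Projective (MvPolynomial (Fin n) K)
      (MvPolynomial (Fin n) K ⧸ (⊥ : Ideal (MvPolynomial (Fin n) K))) :=
      Module.Projective.of_equiv (Submodule.quotEquivOfEqBot _ rfl).symm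
    have := (IsProjective.iff_projective (R := MvPolynomial (Fin n) K) (MvPolynomial (Fin n) K ⧸ (⊥ : Ideal (MvPolynomial (Fin n) K)))).1 this
    infer_instance
  induction N with
  | zero =>
    intro s hs
    obtain rfl : s = ∅ := by simpa using hs
    exact base 0
  | succ N ih =>
    intro s hs
    induction s using Finset.induction_on with
    | empty => exact base _
    | insert b s hb _ =>
      rw [Finset.card_insert_of_notMem hb] at hs
      have h1 := ih (s.image (fun c => c - b)) (Finset.card_image_le.trans (by omega))
      have h2 := ih s (by omega)
      refine pd_step (Ideal.span ((fun s => MvPolynomial.monomial s (1 : K)) ''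
        (s : Set (Fin n →₀ ℕ)))) _ _ (MvPolynomial.monomial b (1:K)) (fun x => ?_) ?_ _ h1 ?_
      · rw [Finset.coe_image]; exact colon_mono _ _ _
      · rw [Finset.coe_insert, Set.image_insert_eq, Ideal.span_insert, sup_comm]
      · exact hasProjectiveDimensionLT_of_ge _ _ _ (Nat.le_succ _)

lemma pd_squares {n q : ℕ} {K : Type} [Field K] (a : Fin q → (Fin n →₀ ℕ)) (s : Finset (Fin n →₀ ℕ))
    (hs : ∀ i j, i ≠ j → a i + a j ∈ s) (t : Finset (Fin q)) :
    HasProjectiveDimensionLT (ModuleCat.of (MvPolynomial (Fin n) K) (MvPolynomial (Fin n) K ⧸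
      Ideal.span ((fun s => MvPolynomial.monomial s (1 : K)) ''
        ((s : Set (Fin n →₀ ℕ)) ∪ (fun i => a i + a i) '' (t : Set (Fin q)))))) (s.card + 2) := by
  classical
  induction t using Finset.induction_on with
  | empty =>
    have := pd_taylor (K := K) s.card s le_rfl
    have e : (s : Set (Fin n →₀ ℕ)) ∪ (fun i => a i + a i) '' ((∅ : Finset (Fin q)) : Set (Fin q)) = s := by simp
    rw [e]
    exact hasProjectiveDimensionLT_of_ge _ _ _ (Nat.le_succ _)
  | insert k t hk ih =>
    have h1 := pd_taylor (K := K) s.card (s.image (fun c => c - (a k + a k))) Finset.card_image_le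
    refine pd_step _ _ _ (MvPolynomial.monomial (a k + a k) (1:K)) (fun x => ?_) ?_ _ h1 ih
    · rw [← colon_mono, Finset.coe_image]
      rw [MvPolynomial.mem_ideal_span_monomial_image, MvPolynomial.mem_ideal_span_monomial_image]
      refine forall₂_congr fun y hy => ?_
      simp only [Set.exists_mem_image, Set.mem_union, or_and_right, exists_or]
      refine ⟨Or.inl, ?_⟩
      rintro (h | ⟨i, hi, hc⟩)
      · exact h
      · have hik : i ≠ k := by rintro rfl; exact hk hi
        refine ⟨_, hs i k hik, fun v => ?_⟩
        have := hc v
        simp only [Finsupp.coe_tsub, Pi.sub_apply, Finsupp.add_apply] at this ⊢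
        omega
    · rw [Finset.coe_insert, Set.image_insert_eq, Set.union_insert, Set.image_insert_eq,
        Ideal.span_insert, sup_comm]

lemma sq_eq {n q : ℕ} {K : Type} [Field K] (a : Fin q → (Fin n →₀ ℕ)) (s : Finset (Fin n →₀ ℕ))
    (hs : ∀ c, c ∈ s ↔ ∃ i j, i ≠ j ∧ a i + a j = c) :
    Ideal.span (Set.range fun i => MvPolynomial.monomial (a i) (1 : K)) *
    Ideal.span (Set.range fun i => MvPolynomial.monomial (a i) (1 : K)) =
      Ideal.span ((fun s => MvPolynomial.monomial s (1 : K)) ''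
        ((s : Set (Fin n →₀ ℕ)) ∪ (fun i => a i + a i) '' ((Finset.univ : Finset (Fin q)) : Set (Fin q)))) := by
  rw [Ideal.span_mul_span']
  congr 1
  ext x
  simp only [Set.mem_mul, Set.mem_range, Set.mem_image, Set.mem_union, Finset.mem_coe, hs]
  constructor
  · rintro ⟨_, ⟨i, rfl⟩, _, ⟨j, rfl⟩, rfl⟩
    refine ⟨a i + a j, ?_, by simp⟩
    by_cases h : i = j
    · subst h; right; exact ⟨i, by simp, rfl⟩
    · left; exact ⟨i, j, h, rfl⟩
  · rintro ⟨_, (⟨i, j, -, rfl⟩ | ⟨i, -, rfl⟩), rfl⟩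
    · exact ⟨_, ⟨i, rfl⟩, _, ⟨j, rfl⟩, by simp⟩
    · exact ⟨_, ⟨i, rfl⟩, _, ⟨i, rfl⟩, by simp⟩

lemma pd_sq {n q : ℕ} {K : Type} [Field K] (a : Fin q → (Fin n →₀ ℕ)) :
   HasProjectiveDimensionLT (ModuleCat.of (MvPolynomial (Fin n) K) 
    (Ideal.span (Set.range fun i => MvPolynomial.monomial (a i) (1 : K)) *
    Ideal.span (Set.range fun i => MvPolynomial.monomial (a i) (1 : K)) : Ideal (MvPolynomial (Fin n) K)))
    (q.choose 2 + 1) := by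
  classical
  let s : Finset (Fin n →₀ ℕ) := ((Finset.univ : Finset (Fin q)).powersetCard 2).image
    (fun u => ∑ i ∈ u, a i)
  have hs : ∀ c, c ∈ s ↔ ∃ i j, i ≠ j ∧ a i + a j = c := by
    intro c
    simp only [s, Finset.mem_image, Finset.mem_powersetCard, Finset.card_eq_two]
    constructor
    · rintro ⟨u, ⟨-, i, j, h, rfl⟩, rfl⟩
      exact ⟨i, j, h, by rw [Finset.sum_pair h]⟩
    · rintro ⟨i, j, h, rfl⟩
      exact ⟨{i, j}, ⟨by simp, i, j, h, rfl⟩, Finset.sum_pair h⟩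
  have hc : s.card ≤ q.choose 2 := by
    refine Finset.card_image_le.trans ?_
    simp
  rw [sq_eq a s hs]
  have := pd_ideal _ _ (pd_squares (K := K) a s (fun i j h => (hs _).2 ⟨i, j, h, rfl⟩) Finset.univ)
  exact hasProjectiveDimensionLT_of_ge _ _ _ (Nat.succ_le_succ hc)

/-- If `I` is an ideal of `S = K[x_1, …, x_n]` generated by `q` monomials, then the
projective dimension of the `S`-module `I²` is at most `C(q,2)`. -/
theorem projDim_sq_le (K : Type) [Field K] (n q : ℕ) (a : Fin q → (Fin n →₀ ℕ))
    (I : Ideal (MvPolynomial (Fin n) K))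
    (hI : I = Ideal.span (Set.range fun i => MvPolynomial.monomial (a i) (1 : K))) :
    HasProjDimLE (MvPolynomial (Fin n) K) (I * I : Ideal (MvPolynomial (Fin n) K))
      (q.choose 2) := by
  subst hI
  exact exists_res _ _ (pd_sq a)
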